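/- Let E and F be real Banach spaces, U ⊆ E and V ⊆ F open sets, and f : U → V a C³ diffeomorphism. Let L_N : ℝ × V × F → ℝ be a regular time dependent Lagrangian of class C², and define L_M(t,x,y) := L_N(t, f(x), df(x)y). Then L_M is a regular time dependent Lagrangian, and the canonical semispray coefficients X₂ᴹ of L_M and X₂ᴺ of L_N satisfy X₂ᴺ(t, f(x), df(x)y) = d²f(x)(y,y) + df(x)[X₂ᴹ(t,x,y)] for all (t,x,y) ∈ ℝ × U × E; that is, the Lagrangian semisprays of L_M and L_N are f-related. -/

import Mathlib

open Set

variable {E : Type*} [NormedAddCommGroup E] [NormedSpace ℝ E]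

/-- `∂₁L(t,x,y)`, partial derivative of the Lagrangian in the time variable. -/
noncomputable def d1L (L : ℝ → E → E → ℝ) (t : ℝ) (x y : E) : ℝ :=
  deriv (fun t' => L t' x y) t

/-- `∂₂L(t,x,y)`, partial Fréchet derivative of the Lagrangian in the base variable. -/
noncomputable def d2L (L : ℝ → E → E → ℝ) (t : ℝ) (x y : E) : E →L[ℝ] ℝ :=
  fderiv ℝ (fun x' => L t x' y) x

/-- `∂₃L(t,x,y)`, partial Fréchet derivative of the Lagrangian in the fiber variable. -/
noncomputable def d3L (L : ℝ → E → E → ℝ) (t : ℝ) (x y : E) : E →L[ℝ] ℝ :=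
  fderiv ℝ (fun y' => L t x y') y

/-- `d13L L t x y z` is `∂₁∂₃L(t,x,y)[z]`, the time derivative of `∂₃L(·,x,y)z`. -/
noncomputable def d13L (L : ℝ → E → E → ℝ) (t : ℝ) (x y : E) : E →L[ℝ] ℝ :=
  deriv (fun t' => d3L L t' x y) t

/-- `d23L L t x y a z` is `∂₂∂₃L(t,x,y)[z,a]`, the derivative in base direction `a` of
`∂₃L(t,·,y)z`. -/
noncomputable def d23L (L : ℝ → E → E → ℝ) (t : ℝ) (x y : E) : E →L[ℝ] E →L[ℝ] ℝ :=
  fderiv ℝ (fun x' => d3L L t x' y) x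

/-- `d33L L t x y w z` is `∂₃²L(t,x,y)[z,w]`, the derivative in fiber direction `w` of
`∂₃L(t,x,·)z`. -/
noncomputable def d33L (L : ℝ → E → E → ℝ) (t : ℝ) (x y : E) : E →L[ℝ] E →L[ℝ] ℝ :=
  fderiv ℝ (fun y' => d3L L t x y') y

/-- A time dependent Lagrangian `L` is regular on `U` if it is C² and at every point of
`ℝ × U × E` the map `X ↦ ∂₃²L(v)[·, X]` is a continuous linear isomorphism `E → E*`. -/
def RegularLagrangian (L : ℝ → E → E → ℝ) (U : Set E) : Prop :=
  ContDiffOn ℝ 2 (fun p : ℝ × E × E => L p.1 p.2.1 p.2.2) (univ ×ˢ U ×ˢ univ) ∧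
  ∀ t : ℝ, ∀ x ∈ U, ∀ y : E,
    ∃ e : E ≃L[ℝ] (E →L[ℝ] ℝ), ∀ X : E, e X = d33L L t x y X

section PartialDerivatives

variable {W : Type*} [NormedAddCommGroup W] [NormedSpace ℝ W]

theorem hasDerivAt_time_slice {G : ℝ × E × E → W} {t : ℝ} {x y : E}
    (h : DifferentiableAt ℝ G (t, x, y)) :
    HasDerivAt (fun s => G (s, x, y)) (fderiv ℝ G (t, x, y) (1, 0, 0)) t :=
  h.hasFDerivAt.comp_hasDerivAt t
    ((hasDerivAt_id t).prodMk ((hasDerivAt_const t x).prodMk (hasDerivAt_const t y)))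

theorem fderiv_base_slice {G : ℝ × E × E → W} {t : ℝ} {x y : E}
    (h : DifferentiableAt ℝ G (t, x, y)) (a : E) :
    fderiv ℝ (fun x' => G (t, x', y)) x a = fderiv ℝ G (t, x, y) (0, a, 0) := by
  have h' := h.hasFDerivAt.comp x (f := fun x' => (t, x', y)) ((hasFDerivAt_const t x).prodMk
    ((hasFDerivAt_id x).prodMk (hasFDerivAt_const y x)))
  exact congrArg (fun T : E →L[ℝ] W => T a) h'.fderiv

theorem fderiv_fiber_slice {G : ℝ × E × E → W} {t : ℝ} {x y : E}
    (h : DifferentiableAt ℝ G (t, x, y)) (b : E) :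
    fderiv ℝ (fun y' => G (t, x, y')) y b = fderiv ℝ G (t, x, y) (0, 0, b) := by
  have h' := h.hasFDerivAt.comp y (f := fun y' => (t, x, y')) ((hasFDerivAt_const t y).prodMk
    ((hasFDerivAt_const x y).prodMk (hasFDerivAt_id y)))
  exact congrArg (fun T : E →L[ℝ] W => T b) h'.fderiv

end PartialDerivatives

section SmoothLagrangian

variable {L : ℝ → E → E → ℝ} {V : Set E}

theorem contDiffAt_lagrangian (hV : IsOpen V)
    (hL : ContDiffOn ℝ 2 (fun p : ℝ × E × E => L p.1 p.2.1 p.2.2) (univ ×ˢ V ×ˢ univ))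
    (t : ℝ) {x : E} (hx : x ∈ V) (y : E) :
    ContDiffAt ℝ 2 (fun p : ℝ × E × E => L p.1 p.2.1 p.2.2) (t, x, y) :=
  hL.contDiffAt ((isOpen_univ.prod (hV.prod isOpen_univ)).mem_nhds
    ⟨mem_univ _, hx, mem_univ _⟩)

theorem differentiableAt_lagrangian (hV : IsOpen V)
    (hL : ContDiffOn ℝ 2 (fun p : ℝ × E × E => L p.1 p.2.1 p.2.2) (univ ×ˢ V ×ˢ univ))
    (t : ℝ) {x : E} (hx : x ∈ V) (y : E) :
    DifferentiableAt ℝ (fun p : ℝ × E × E => L p.1 p.2.1 p.2.2) (t, x, y) :=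
  (contDiffAt_lagrangian hV hL t hx y).differentiableAt (by norm_num)

theorem differentiableAt_d3L (hV : IsOpen V)
    (hL : ContDiffOn ℝ 2 (fun p : ℝ × E × E => L p.1 p.2.1 p.2.2) (univ ×ˢ V ×ˢ univ))
    (t : ℝ) {x : E} (hx : x ∈ V) (y : E) :
    DifferentiableAt ℝ (fun p : ℝ × E × E => d3L L p.1 p.2.1 p.2.2) (t, x, y) := by
  set G : ℝ × E × E → ℝ := fun p => L p.1 p.2.1 p.2.2 with hG
  have h1 : DifferentiableAt ℝ (fderiv ℝ G) (t, x, y) :=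
    ((contDiffAt_lagrangian hV hL t hx y).fderiv_right (m := 1) (by norm_num)).differentiableAt
      (by norm_num)
  have h2 : DifferentiableAt ℝ (fun p => (fderiv ℝ G p).comp
      ((ContinuousLinearMap.inr ℝ ℝ (E × E)).comp (ContinuousLinearMap.inr ℝ E E))) (t, x, y) :=
    h1.clm_comp (differentiableAt_const _)
  refine h2.congr_of_eventuallyEq ?_
  filter_upwards [(isOpen_univ.prod (hV.prod isOpen_univ)).mem_nhds
    (show (t, x, y) ∈ univ ×ˢ V ×ˢ univ from ⟨mem_univ _, hx, mem_univ _⟩)] with p hp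
  ext b
  exact fderiv_fiber_slice (differentiableAt_lagrangian hV hL p.1 hp.2.1 p.2.2) b

end SmoothLagrangian

section Pullback

variable {F : Type*} [NormedAddCommGroup F] [NormedSpace ℝ F]
  {U : Set E} {V : Set F} {f : E → F} {df : E → E →L[ℝ] F} {d2f : E → E →L[ℝ] E →L[ℝ] F}
  {LN : ℝ → F → F → ℝ} {LM : ℝ → E → E → ℝ}

theorem contDiffOn_pullback_lagrangian (hU : IsOpen U) (hf : ContDiffOn ℝ 3 f U)
    (hfUV : MapsTo f U V) (hdf : ∀ x ∈ U, HasFDerivAt f (df x) x)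
    (hLN : ContDiffOn ℝ 2 (fun p : ℝ × F × F => LN p.1 p.2.1 p.2.2) (univ ×ˢ V ×ˢ univ))
    (hLM : ∀ (t : ℝ) (x y : E), LM t x y = LN t (f x) (df x y)) :
    ContDiffOn ℝ 2 (fun p : ℝ × E × E => LM p.1 p.2.1 p.2.2) (univ ×ˢ U ×ˢ univ) := by
  have hbase : MapsTo (fun p : ℝ × E × E => p.2.1) (univ ×ˢ U ×ˢ univ) U := fun p hp => hp.2.1
  have hdf2 : ContDiffOn ℝ 2 df U :=
    (hf.fderiv_of_isOpen hU (m := 2) (by norm_num)).congr fun x hx => (hdf x hx).fderiv.symm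
  have hsnd : ContDiffOn ℝ 2 (fun p : ℝ × E × E => p.2.1) (univ ×ˢ U ×ˢ univ) :=
    contDiff_snd.fst.contDiffOn
  have hchange : ContDiffOn ℝ 2 (fun p : ℝ × E × E => (p.1, f p.2.1, df p.2.1 p.2.2))
      (univ ×ˢ U ×ˢ univ) :=
    contDiff_fst.contDiffOn.prodMk
      (((hf.of_le (by norm_num)).comp hsnd hbase).prodMk
        ((hdf2.comp hsnd hbase).clm_apply contDiff_snd.snd.contDiffOn))
  refine (hLN.comp hchange fun p hp => ⟨mem_univ _, hfUV hp.2.1, mem_univ _⟩).congr ?_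
  intro p _
  exact hLM _ _ _

theorem d3L_pullback (hV : IsOpen V) (hfUV : MapsTo f U V)
    (hLN : ContDiffOn ℝ 2 (fun p : ℝ × F × F => LN p.1 p.2.1 p.2.2) (univ ×ˢ V ×ˢ univ))
    (hLM : ∀ (t : ℝ) (x y : E), LM t x y = LN t (f x) (df x y))
    (t : ℝ) {x : E} (hx : x ∈ U) (y : E) :
    d3L LM t x y = (d3L LN t (f x) (df x y)).comp (df x) := by
  have hG : DifferentiableAt ℝ (fun y' => LN t (f x) y') (df x y) :=
    (differentiableAt_lagrangian hV hLN t (hfUV hx) (df x y)).comp (df x y)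
      (f := fun y' => (t, f x, y')) (by fun_prop)
  have h := hG.hasFDerivAt.comp y (df x).hasFDerivAt
  rw [d3L, funext (hLM t x)]
  exact h.fderiv

theorem d33L_pullback (hV : IsOpen V) (hfUV : MapsTo f U V)
    (hLN : ContDiffOn ℝ 2 (fun p : ℝ × F × F => LN p.1 p.2.1 p.2.2) (univ ×ˢ V ×ˢ univ))
    (hLM : ∀ (t : ℝ) (x y : E), LM t x y = LN t (f x) (df x y))
    (t : ℝ) {x : E} (hx : x ∈ U) (y w : E) :
    d33L LM t x y w = (d33L LN t (f x) (df x y) (df x w)).comp (df x) := by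
  have hD : DifferentiableAt ℝ (fun y' => d3L LN t (f x) y') (df x y) :=
    (differentiableAt_d3L hV hLN t (hfUV hx) (df x y)).comp (df x y)
      (f := fun y' => (t, f x, y')) (by fun_prop)
  have h := (hD.hasFDerivAt.comp y (df x).hasFDerivAt).clm_comp (hasFDerivAt_const (df x) y)
  rw [d33L, funext fun y' => d3L_pullback hV hfUV hLN hLM t hx y']
  ext z
  have h' := congrArg (fun T : E →L[ℝ] E →L[ℝ] ℝ => T w z) h.fderiv
  simpa [d33L, Function.comp_def] using h'

theorem d13L_pullback (hV : IsOpen V) (hfUV : MapsTo f U V)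
    (hLN : ContDiffOn ℝ 2 (fun p : ℝ × F × F => LN p.1 p.2.1 p.2.2) (univ ×ˢ V ×ˢ univ))
    (hLM : ∀ (t : ℝ) (x y : E), LM t x y = LN t (f x) (df x y))
    (t : ℝ) {x : E} (hx : x ∈ U) (y : E) :
    d13L LM t x y = (d13L LN t (f x) (df x y)).comp (df x) := by
  have hD := hasDerivAt_time_slice (differentiableAt_d3L hV hLN t (hfUV hx) (df x y))
  have h := hD.clm_comp (hasDerivAt_const t (df x))
  rw [d13L, funext fun s => d3L_pullback hV hfUV hLN hLM s hx y, d13L, hD.deriv]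
  simpa using h.deriv

theorem d2L_pullback (hV : IsOpen V) (hfUV : MapsTo f U V)
    (hdf : ∀ x ∈ U, HasFDerivAt f (df x) x) (hd2f : ∀ x ∈ U, HasFDerivAt df (d2f x) x)
    (hLN : ContDiffOn ℝ 2 (fun p : ℝ × F × F => LN p.1 p.2.1 p.2.2) (univ ×ˢ V ×ˢ univ))
    (hLM : ∀ (t : ℝ) (x y : E), LM t x y = LN t (f x) (df x y))
    (t : ℝ) {x : E} (hx : x ∈ U) (y z : E) :
    d2L LM t x y z
      = d2L LN t (f x) (df x y) (df x z) + d3L LN t (f x) (df x y) (d2f x z y) := by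
  have hG := differentiableAt_lagrangian hV hLN t (hfUV hx) (df x y)
  have h := hG.hasFDerivAt.comp x ((hasFDerivAt_const t x).prodMk
    ((hdf x hx).prodMk ((hd2f x hx).clm_apply (hasFDerivAt_const y x))))
  rw [d2L, funext fun x' => hLM t x' y, d2L, d3L, fderiv_base_slice hG, fderiv_fiber_slice hG,
    ← map_add]
  have h' := congrArg (fun T : E →L[ℝ] ℝ => T z) h.fderiv
  simpa [Function.comp_def] using h'

theorem d23L_pullback (hU : IsOpen U) (hV : IsOpen V) (hfUV : MapsTo f U V)
    (hdf : ∀ x ∈ U, HasFDerivAt f (df x) x) (hd2f : ∀ x ∈ U, HasFDerivAt df (d2f x) x)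
    (hLN : ContDiffOn ℝ 2 (fun p : ℝ × F × F => LN p.1 p.2.1 p.2.2) (univ ×ˢ V ×ˢ univ))
    (hLM : ∀ (t : ℝ) (x y : E), LM t x y = LN t (f x) (df x y))
    (t : ℝ) {x : E} (hx : x ∈ U) (y a z : E) :
    d23L LM t x y a z
      = d23L LN t (f x) (df x y) (df x a) (df x z)
        + d33L LN t (f x) (df x y) (d2f x a y) (df x z)
        + d3L LN t (f x) (df x y) (d2f x a z) := by
  have hD := differentiableAt_d3L hV hLN t (hfUV hx) (df x y)
  have h := (hD.hasFDerivAt.comp x ((hasFDerivAt_const t x).prodMk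
    ((hdf x hx).prodMk ((hd2f x hx).clm_apply (hasFDerivAt_const y x))))).clm_comp (hd2f x hx)
  have heq : (fun x' => d3L LM t x' y) =ᶠ[nhds x]
      fun x' => (d3L LN t (f x') (df x' y)).comp (df x') := by
    filter_upwards [hU.mem_nhds hx] with x' hx'
    exact d3L_pullback hV hfUV hLN hLM t hx' y
  rw [d23L, heq.fderiv_eq, d23L, d33L, fderiv_base_slice hD, fderiv_fiber_slice hD,
    ← add_apply, ← map_add]
  have h' := congrArg (fun T : E →L[ℝ] E →L[ℝ] ℝ => T a z) h.fderiv
  simpa [add_comm, Function.comp_def] using h'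

end Pullback

/-- If `L_N` is a regular time dependent Lagrangian on `V ⊆ F` and
`L_M(t,x,y) = L_N(t, f(x), df(x)y)` its pullback through a C³ diffeomorphism
`f : U → V`, then `L_M` is regular and the canonical semispray coefficients satisfy
`X₂ᴺ(t, f(x), df(x)y) = d²f(x)(y,y) + df(x)[X₂ᴹ(t,x,y)]`; that is, the Lagrangian
semisprays of `L_M` and `L_N` are `f`-related. -/
theorem pullback_lagrangian_semisprays_f_related
    {E : Type*} [NormedAddCommGroup E] [NormedSpace ℝ E] [CompleteSpace E]
    {F : Type*} [NormedAddCommGroup F] [NormedSpace ℝ F] [CompleteSpace F]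
    (U : Set E) (V : Set F) (hU : IsOpen U) (hV : IsOpen V)
    (f : E → F) (g : F → E) (hf : ContDiffOn ℝ 3 f U) (hg : ContDiffOn ℝ 3 g V)
    (hfUV : MapsTo f U V) (hgVU : MapsTo g V U)
    (hleft : ∀ x ∈ U, g (f x) = x) (hright : ∀ y ∈ V, f (g y) = y)
    (df : E → E →L[ℝ] F) (hdf : ∀ x ∈ U, HasFDerivAt f (df x) x)
    (d2f : E → E →L[ℝ] E →L[ℝ] F) (hd2f : ∀ x ∈ U, HasFDerivAt df (d2f x) x)
    (LN : ℝ → F → F → ℝ) (hregN : RegularLagrangian LN V)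
    (LM : ℝ → E → E → ℝ)
    (hLM : ∀ (t : ℝ) (x y : E), LM t x y = LN t (f x) (df x y))
    (X₂M : ℝ → E → E → E) (X₂N : ℝ → F → F → F)
    (hX₂M : ∀ t : ℝ, ∀ x ∈ U, ∀ y z : E,
      d33L LM t x y (X₂M t x y) z
        = d2L LM t x y z - d13L LM t x y z - d23L LM t x y y z)
    (hX₂N : ∀ t : ℝ, ∀ x' ∈ V, ∀ y' z' : F,
      d33L LN t x' y' (X₂N t x' y') z'
        = d2L LN t x' y' z' - d13L LN t x' y' z' - d23L LN t x' y' y' z') :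
    RegularLagrangian LM U ∧
    ∀ t : ℝ, ∀ x ∈ U, ∀ y : E,
      X₂N t (f x) (df x y) = d2f x y y + df x (X₂M t x y) := by
  have hLN := hregN.1
  have hequiv : ∀ x ∈ U, ∃ e : E ≃L[ℝ] F, (e : E →L[ℝ] F) = df x := by
    intro x hx
    have hgx : HasFDerivAt g (fderiv ℝ g (f x)) (f x) :=
      ((hg.contDiffAt (hV.mem_nhds (hfUV hx))).differentiableAt (by norm_num)).hasFDerivAt
    have hgf : (fderiv ℝ g (f x)).comp (df x) = ContinuousLinearMap.id ℝ E :=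
      (hgx.comp x (hdf x hx)).unique ((hasFDerivAt_id x).congr_of_eventuallyEq
        (by filter_upwards [hU.mem_nhds hx] with x' hx' using hleft x' hx'))
    have hdf' : HasFDerivAt f (df x) (g (f x)) := by
      rw [hleft x hx]
      exact hdf x hx
    have hfg : (df x).comp (fderiv ℝ g (f x)) = ContinuousLinearMap.id ℝ F :=
      (hdf'.comp (f x) hgx).unique ((hasFDerivAt_id (f x)).congr_of_eventuallyEq
        (by filter_upwards [hV.mem_nhds (hfUV hx)] with y' hy' using hright y' hy'))
    exact ⟨ContinuousLinearEquiv.equivOfInverse (df x) (fderiv ℝ g (f x))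
      (fun v => DFunLike.congr_fun hgf v) (fun v => DFunLike.congr_fun hfg v), rfl⟩
  refine ⟨⟨contDiffOn_pullback_lagrangian hU hf hfUV hdf hLN hLM, ?_⟩, ?_⟩
  · intro t x hx y
    obtain ⟨e, he⟩ := hequiv x hx
    obtain ⟨eN, heN⟩ := hregN.2 t (f x) (hfUV hx) (df x y)
    refine ⟨(e.trans eN).trans (e.symm.arrowCongr (ContinuousLinearEquiv.refl ℝ ℝ)), ?_⟩
    intro X
    rw [d33L_pullback hV hfUV hLN hLM t hx y X, ← heN, ← he]
    ext z
    simp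
  · intro t x hx y
    obtain ⟨e, he⟩ := hequiv x hx
    obtain ⟨eN, heN⟩ := hregN.2 t (f x) (hfUV hx) (df x y)
    apply eN.injective
    rw [map_add, heN, heN, heN]
    ext w
    obtain ⟨z, rfl⟩ : ∃ z, df x z = w := ⟨e.symm w, by rw [← he]; simp⟩
    have hsymm : d2f x y z = d2f x z y :=
      second_derivative_symmetric_of_eventually
        (by filter_upwards [hU.mem_nhds hx] with x' hx' using hdf x' hx') (hd2f x hx) y z
    have hM := hX₂M t x hx y z
    rw [d33L_pullback hV hfUV hLN hLM t hx, d13L_pullback hV hfUV hLN hLM t hx,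
      d2L_pullback hV hfUV hdf hd2f hLN hLM t hx,
      d23L_pullback hU hV hfUV hdf hd2f hLN hLM t hx, hsymm] at hM
    have hN := hX₂N t (f x) (hfUV hx) (df x y) (df x z)
    simp only [ContinuousLinearMap.comp_apply] at hM
    rw [add_apply]
    linarith
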